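/- arXiv:cs/0702007 — 7 statements merged into one kernel-verified Lean document; each statement's English description precedes it below -/
import Mathlib

section
/- The function F(R) = Σ_{k=1}^N (V N_0/d_k)(e^{R_k} − 1) e^{S_{k−1}} − Σ_{k=1}^N Q_k R_k is strictly convex on the nonnegative orthant {R ∈ ℝ^N : R_k ≥ 0 for all k}. -/
/-- Summation by parts on an initial segment of `ℕ`. -/
theorem sum_range_mul_sub_succ (c f : ℕ → ℝ) (n : ℕ) :
    ∑ k ∈ Finset.range n, c k * (f (k + 1) - f k) =
      ∑ k ∈ Finset.range n, (c k - c (k + 1)) * f (k + 1) + c n * f n - c 0 * f 0 := by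
  induction n with
  | zero => simp
  | succ n ih =>
    rw [Finset.sum_range_succ, Finset.sum_range_succ, ih]
    ring

/-- A positive combination of exponentials of linear forms that jointly separate points is
strictly convex. -/
theorem strictConvexOn_sum_mul_exp {E ι : Type*} [AddCommGroup E] [Module ℝ E]
    (t : Finset ι) {s : Set E} (hs : Convex ℝ s) (w : ι → ℝ) (hw : ∀ i ∈ t, 0 < w i)
    (L : ι → E →ₗ[ℝ] ℝ) (hL : ∀ x y, (∀ i ∈ t, L i x = L i y) → x = y) :
    StrictConvexOn ℝ s (fun x => ∑ i ∈ t, w i * Real.exp (L i x)) := by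
  refine ⟨hs, fun x _ y _ hxy a b ha hb hab => ?_⟩
  simp only [smul_eq_mul, Finset.mul_sum, ← Finset.sum_add_distrib, map_add, map_smul]
  obtain ⟨j, hj, hne⟩ : ∃ j ∈ t, L j x ≠ L j y := by
    by_contra! h
    exact hxy (hL x y h)
  refine Finset.sum_lt_sum (fun i hi => ?_) ⟨j, hj, ?_⟩
  · have h := convexOn_exp.2 (Set.mem_univ (L i x)) (Set.mem_univ (L i y)) ha.le hb.le hab
    simp only [smul_eq_mul] at h
    nlinarith [mul_le_mul_of_nonneg_left h (hw i hi).le]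
  · have h := strictConvexOn_exp.2 (Set.mem_univ (L j x)) (Set.mem_univ (L j y)) hne ha hb hab
    simp only [smul_eq_mul] at h
    nlinarith [mul_lt_mul_of_pos_left h (hw j hj)]

/-- The sum of the coordinates of index less than `j`, as a linear form. -/
def partialSum (N j : ℕ) : (Fin N → ℝ) →ₗ[ℝ] ℝ :=
  ∑ i ∈ Finset.univ.filter (fun i : Fin N => i.val < j), LinearMap.proj i

theorem partialSum_apply (N j : ℕ) (R : Fin N → ℝ) :
    partialSum N j R = ∑ i ∈ Finset.univ.filter (fun i : Fin N => i.val < j), R i := by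
  simp [partialSum]

theorem partialSum_zero (N : ℕ) (R : Fin N → ℝ) : partialSum N 0 R = 0 := by
  simp [partialSum_apply]

theorem partialSum_succ {N : ℕ} (k : Fin N) (R : Fin N → ℝ) :
    partialSum N (k + 1) R = R k + partialSum N k R := by
  rw [partialSum_apply, partialSum_apply, ← Finset.sum_insert (by simp)]
  congr 1
  ext i
  simp only [Finset.mem_filter, Finset.mem_univ, true_and, Finset.mem_insert, Fin.ext_iff]
  omega

theorem eq_of_partialSum_eq {N : ℕ} {x y : Fin N → ℝ}
    (h : ∀ j ∈ Finset.range N, partialSum N (j + 1) x = partialSum N (j + 1) y) : x = y := by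
  have h' : ∀ j ≤ N, partialSum N j x = partialSum N j y := by
    rintro (_ | j) hj
    · simp [partialSum_zero]
    · exact h j (Finset.mem_range.2 hj)
  ext k
  have h₁ := h' (k + 1) k.isLt
  rw [partialSum_succ, partialSum_succ, h' k k.isLt.le] at h₁
  exact add_right_cancel h₁

/-- The objective `F` of optimization (O2) is strictly convex on the
nonnegative orthant. -/
theorem strictConvexOn_O2 (N : ℕ) (hN : 0 < N) (d : Fin N → ℝ)
    (hd : StrictMono d) (hdpos : ∀ k, 0 < d k)
    (V N0 : ℝ) (hV : 0 < V) (hN0 : 0 < N0) (Q : Fin N → ℝ) :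
    StrictConvexOn ℝ {R : Fin N → ℝ | ∀ k, 0 ≤ R k}
      (fun R : Fin N → ℝ =>
        (∑ k : Fin N, (V * N0 / d k) * (Real.exp (R k) - 1) *
            Real.exp (∑ i ∈ Finset.univ.filter (fun i => i < k), R i)) -
          ∑ k : Fin N, Q k * R k) := by
  set c : ℕ → ℝ := fun j => if h : j < N then V * N0 / d ⟨j, h⟩ else 0 with hc
  have hcN : c N = 0 := by simp [hc]
  have hVN : 0 < V * N0 := mul_pos hV hN0
  have hw : ∀ k ∈ Finset.range N, 0 < c k - c (k + 1) := by
    intro k hk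
    have hk : k < N := Finset.mem_range.1 hk
    rw [sub_pos]
    by_cases hk' : k + 1 < N
    · simp only [hc, hk, hk', dite_true]
      exact div_lt_div_of_pos_left hVN (hdpos _) (hd (Fin.mk_lt_mk.2 k.lt_succ_self))
    · simp only [hc, hk, hk', dite_true, dite_false]
      exact div_pos hVN (hdpos _)
  have hs : Convex ℝ {R : Fin N → ℝ | ∀ k, 0 ≤ R k} := convex_Ici (0 : Fin N → ℝ)
  have hlin : ConvexOn ℝ {R : Fin N → ℝ | ∀ k, 0 ≤ R k}
      (fun R => -c 0 - ∑ k : Fin N, Q k * R k) := by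
    refine ⟨hs, fun x _ y _ a b _ _ hab => le_of_eq ?_⟩
    have hsum : ∑ k : Fin N, Q k * (a • x + b • y) k =
        a * ∑ k : Fin N, Q k * x k + b * ∑ k : Fin N, Q k * y k := by
      rw [Finset.mul_sum, Finset.mul_sum, ← Finset.sum_add_distrib]
      refine Finset.sum_congr rfl fun k _ => ?_
      simp only [Pi.add_apply, Pi.smul_apply, smul_eq_mul]
      ring
    beta_reduce
    rw [hsum]
    simp only [smul_eq_mul]
    linear_combination c 0 * hab
  have hexp := strictConvexOn_sum_mul_exp (Finset.range N) hs (fun k => c k - c (k + 1)) hw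
    (fun k => partialSum N (k + 1)) (fun _ _ => eq_of_partialSum_eq)
  refine (hexp.add_convexOn hlin).congr fun R _ => ?_
  have hparts := sum_range_mul_sub_succ c (fun j => Real.exp (partialSum N j R)) N
  rw [hcN, partialSum_zero, Real.exp_zero, ← Fin.sum_univ_eq_sum_range
    (fun k => c k * (Real.exp (partialSum N (k + 1) R) - Real.exp (partialSum N k R)))] at hparts
  have hterm : ∑ k : Fin N, (V * N0 / d k) * (Real.exp (R k) - 1) *
        Real.exp (∑ i ∈ Finset.univ.filter (fun i => i < k), R i) =
      ∑ k : Fin N, c k * (Real.exp (partialSum N (k + 1) R) - Real.exp (partialSum N k R)) := by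
    refine Finset.sum_congr rfl fun k _ => ?_
    have hck : c k = V * N0 / d k := by simp [hc]
    have hSk : ∑ i ∈ Finset.univ.filter (fun i => i < k), R i = partialSum N k R := by
      simp only [partialSum_apply, Fin.lt_def]
    rw [partialSum_succ, Real.exp_add, hck, hSk]
    ring
  simp only [Pi.add_apply]
  rw [hterm, hparts]
  ring
end

section
/- Suppose R ∈ ℝ^N satisfies the stationarity equations: for every k ∈ {1,…,N}, Σ_{i=k+1}^N (V N_0/d_i)(e^{R_i} − 1) e^{S_{i−1}} + (V N_0/d_k) e^{S_k} = Q_k + λ_k. Then for every k ∈ {1,…,N}, e^{S_k} = [(Q_k + λ_k) − (Q_{k+1} + λ_{k+1})] / (V N_0 (1/d_k − 1/d_{k+1})), where by convention 1/d_{N+1} = 0 and Q_{N+1} = λ_{N+1} = 0. -/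
/-- if `R` satisfies the stationarity equations, then for every `k ∈ {1,…,N}`,
`e^{S k} = [(Q k + λ k) − (Q (k+1) + λ (k+1))] / (V N₀ (1/d k − 1/d (k+1)))`,
with the conventions `1/d (N+1) = 0` and `Q (N+1) = λ (N+1) = 0`. -/
theorem exp_partial_sum_of_stationarity (N : ℕ) (hN : 0 < N) (d : ℕ → ℝ)
    (hd : ∀ j, 1 ≤ j → j < N → d j < d (j + 1))
    (hdpos : ∀ j, 1 ≤ j → j ≤ N → 0 < d j)
    (hdconv : 1 / d (N + 1) = 0)
    (V N0 : ℝ) (hV : 0 < V) (hN0 : 0 < N0)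
    (Q lam : ℕ → ℝ) (hQconv : Q (N + 1) = 0) (hlamconv : lam (N + 1) = 0)
    (R : ℕ → ℝ)
    (hstat : ∀ k, 1 ≤ k → k ≤ N →
      (∑ i ∈ Finset.Icc (k + 1) N, (V * N0 / d i) * (Real.exp (R i) - 1) *
          Real.exp (∑ u ∈ Finset.Icc 1 (i - 1), R u)) +
        (V * N0 / d k) * Real.exp (∑ i ∈ Finset.Icc 1 k, R i) = Q k + lam k) :
    ∀ k, 1 ≤ k → k ≤ N →
      Real.exp (∑ i ∈ Finset.Icc 1 k, R i) =
        ((Q k + lam k) - (Q (k + 1) + lam (k + 1))) /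
          (V * N0 * (1 / d k - 1 / d (k + 1))) := by
  intro k hk1 hkN
  have hdk := hdpos k hk1 hkN
  have hVN : 0 < V * N0 := mul_pos hV hN0
  have hk := hstat k hk1 hkN
  rcases hkN.lt_or_eq with hlt | rfl
  · have hdk' := hdpos (k + 1) (by omega) hlt
    have hgap : 0 < 1 / d k - 1 / d (k + 1) :=
      sub_pos.mpr (one_div_lt_one_div_of_lt hdk (hd k hk1 hlt))
    have hnext := hstat (k + 1) (by omega) hlt
    rw [← Finset.add_sum_Ioc_eq_sum_Icc (Nat.succ_le_of_lt hlt),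
      ← Finset.Icc_add_one_left_eq_Ioc, Nat.succ_eq_add_one, Nat.add_sub_cancel] at hk
    rw [Finset.sum_Icc_succ_top (by omega : 1 ≤ k + 1), Real.exp_add] at hnext
    rw [eq_div_iff (mul_pos hVN hgap).ne', ← hk, ← hnext]
    ring
  · rw [Finset.Icc_eq_empty (by omega : ¬ k + 1 ≤ k), Finset.sum_empty] at hk
    rw [hdconv, hQconv, hlamconv, ← hk]
    field_simp
    ring
end

section
/- Suppose (Q_k + λ_k) − (Q_{k+1} + λ_{k+1}) > 0 for every k ∈ {1,…,N} (with the conventions Q_{N+1} = λ_{N+1} = 0 and 1/d_{N+1} = 0), and define R_1 = log( [(Q_1+λ_1) − (Q_2+λ_2)] / (V N_0 (1/d_1 − 1/d_2)) ) and, for 1 < k ≤ N, R_k = log( [(Q_k+λ_k) − (Q_{k+1}+λ_{k+1})](1/d_{k−1} − 1/d_k) / ( [(Q_{k−1}+λ_{k−1}) − (Q_k+λ_k)](1/d_k − 1/d_{k+1}) ) ). Then for every k ∈ {1,…,N}, Σ_{i=k+1}^N (V N_0/d_i)(e^{R_i} − 1) e^{S_{i−1}} + (V N_0/d_k) e^{S_k}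 = Q_k + λ_k; that is, all stationarity equations ∂F(R,λ)/∂R_k = 0 are satisfied. -/
/-- Logarithms of consecutive ratios of a positive sequence telescope. -/
theorem exp_sum_Icc_log_ratio {N : ℕ} {x R : ℕ → ℝ}
    (hx : ∀ k, 1 ≤ k → k ≤ N → 0 < x k) (h1 : R 1 = Real.log (x 1))
    (hR : ∀ k, 1 < k → k ≤ N → R k = Real.log (x k / x (k - 1))) {k : ℕ} (hk : 1 ≤ k) :
    k ≤ N → Real.exp (∑ i ∈ Finset.Icc 1 k, R i) = x k := by
  induction k, hk using Nat.le_induction with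
  | base =>
    intro hN
    simp [h1, Real.exp_log (hx 1 le_rfl hN)]
  | succ k hk ih =>
    intro hN
    have hpos := hx k hk (by omega)
    have hpos' := hx (k + 1) (by omega) hN
    rw [Finset.sum_Icc_succ_top (by omega), Real.exp_add, ih (by omega), hR (k + 1) (by omega) hN,
      Nat.add_sub_cancel, Real.exp_log (div_pos hpos' hpos)]
    field_simp

/-- Summation by parts: the marginal costs at stage `k` add up to `a k` as soon as the weighted
exponentials of the partial sums are the successive differences of `a`. -/
theorem sum_Icc_mul_exp_sub_one_add {N : ℕ} {c a R : ℕ → ℝ}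
    (hc : c (N + 1) = 0) (ha : a (N + 1) = 0)
    (h : ∀ k, 1 ≤ k → k ≤ N →
      (c k - c (k + 1)) * Real.exp (∑ i ∈ Finset.Icc 1 k, R i) = a k - a (k + 1))
    {k : ℕ} (hkN : k ≤ N) : 1 ≤ k →
    (∑ i ∈ Finset.Icc (k + 1) N, c i * (Real.exp (R i) - 1) *
      Real.exp (∑ u ∈ Finset.Icc 1 (i - 1), R u)) +
        c k * Real.exp (∑ i ∈ Finset.Icc 1 k, R i) = a k := by
  induction hkN using Nat.decreasingInduction with
  | self =>
    intro hN
    have := h N hN le_rfl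
    rw [hc, ha, sub_zero, sub_zero] at this
    simpa using this
  | of_succ k hk ih =>
    intro h1
    have hnext := ih (by omega)
    have hcur := h k h1 hk.le
    rw [Finset.sum_Icc_succ_top (by omega), Real.exp_add] at hnext
    rw [← Finset.add_sum_Ioc_eq_sum_Icc (by omega), ← Finset.Icc_add_one_left_eq_Ioc,
      Nat.add_sub_cancel]
    linear_combination hnext + hcur


/-- if all differences `(Q k + λ k) − (Q (k+1) + λ (k+1))` are positive and the
rates are given by the closed-form log formulas, then all stationarity equations
`∂F(R,λ)/∂R k = 0` are satisfied.  Conventions: `1/d (N+1) = 0` and `Q (N+1) = λ (N+1) = 0`. -/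
theorem stationarity_of_closed_form_rates (N : ℕ) (hN : 0 < N) (d : ℕ → ℝ)
    (hd : ∀ j, 1 ≤ j → j < N → d j < d (j + 1))
    (hdpos : ∀ j, 1 ≤ j → j ≤ N → 0 < d j)
    (hdconv : 1 / d (N + 1) = 0)
    (V N0 : ℝ) (hV : 0 < V) (hN0 : 0 < N0)
    (Q lam : ℕ → ℝ) (hQconv : Q (N + 1) = 0) (hlamconv : lam (N + 1) = 0)
    (hdiff : ∀ k, 1 ≤ k → k ≤ N → 0 < (Q k + lam k) - (Q (k + 1) + lam (k + 1)))
    (R : ℕ → ℝ)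
    (hR1 : R 1 = Real.log (((Q 1 + lam 1) - (Q 2 + lam 2)) /
      (V * N0 * (1 / d 1 - 1 / d 2))))
    (hRk : ∀ k, 1 < k → k ≤ N →
      R k = Real.log ((((Q k + lam k) - (Q (k + 1) + lam (k + 1))) *
          (1 / d (k - 1) - 1 / d k)) /
        ((((Q (k - 1) + lam (k - 1)) - (Q k + lam k))) *
          (1 / d k - 1 / d (k + 1))))) :
    ∀ k, 1 ≤ k → k ≤ N →
      (∑ i ∈ Finset.Icc (k + 1) N, (V * N0 / d i) * (Real.exp (R i) - 1) *
          Real.exp (∑ u ∈ Finset.Icc 1 (i - 1), R u)) +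
        (V * N0 / d k) * Real.exp (∑ i ∈ Finset.Icc 1 k, R i) = Q k + lam k := by
  have gap_pos : ∀ k, 1 ≤ k → k ≤ N → 0 < 1 / d k - 1 / d (k + 1) := by
    intro k h1 hk
    rcases hk.lt_or_eq with hlt | rfl
    · exact sub_pos.2 (one_div_lt_one_div_of_lt (hdpos k h1 hk) (hd k h1 hlt))
    · rw [hdconv, sub_zero]
      exact one_div_pos.2 (hdpos k h1 le_rfl)
  have hVN : 0 < V * N0 := mul_pos hV hN0
  have hexp : ∀ k, 1 ≤ k → k ≤ N → Real.exp (∑ i ∈ Finset.Icc 1 k, R i) =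
      ((Q k + lam k) - (Q (k + 1) + lam (k + 1))) / (V * N0 * (1 / d k - 1 / d (k + 1))) := by
    intro k h1 hk
    refine exp_sum_Icc_log_ratio
      (x := fun k => ((Q k + lam k) - (Q (k + 1) + lam (k + 1))) /
        (V * N0 * (1 / d k - 1 / d (k + 1))))
      (fun j hj hjN => div_pos (hdiff j hj hjN) (mul_pos hVN (gap_pos j hj hjN)))
      hR1 (fun j hj hjN => ?_) h1 hk
    obtain ⟨m, rfl⟩ : ∃ m, j = m + 1 := ⟨j - 1, by omega⟩
    rw [hRk (m + 1) hj hjN]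
    simp only [Nat.add_sub_cancel]
    rw [div_div_div_eq, mul_left_comm _ (V * N0), mul_right_comm (V * N0),
      mul_assoc (V * N0), mul_div_mul_left _ _ hVN.ne']
  intro k h1 hk
  refine sum_Icc_mul_exp_sub_one_add (c := fun i => V * N0 / d i) (a := fun i => Q i + lam i)
    ?_ (by simp [hQconv, hlamconv]) (fun j hj hjN => ?_) hk h1
  · simpa using Or.inr (by simpa using hdconv)
  · have hg := mul_pos hVN (gap_pos j hj hjN)
    rw [hexp j hj hjN, show V * N0 / d j - V * N0 / d (j + 1) =
      V * N0 * (1 / d j - 1 / d (j + 1)) by ring, mul_div_cancel₀ _ hg.ne']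
end

section
/- Let 2 ≤ m ≤ N. For n ∈ {2,…,m−1} define λ_n = [Q_1(1/d_n − 1/d_m) + Q_m(1/d_1 − 1/d_n)]/(1/d_1 − 1/d_m) − Q_n, and set λ_m = 0 (the same formula gives 0 at n = 1 and n = m). Suppose Q_1 < V N_0 (1/d_1 − 1/d_2) + Q_2 + λ_2 (reading λ_2 = 0 if m = 2). Then: (a) Q_1 < V N_0 (1/d_1 − 1/d_m) + Q_m; (b) setting λ'_n = V N_0 (1/d_n − 1/d_m) + Q_m − Q_n for n ∈ {1,…,m−1}, one has λ'_1 > 0, and for every n ∈ {2,…,m−1}, λ'_n − λ_n = ((1/d_n − 1/d_m)/(1/d_1 − 1/d_m)) · λ'_1 ≥ 0. -/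
/-- A sequence increasing stepwise on `{1, …, N}` is strictly increasing there. -/
theorem lt_of_stepwise_lt {N : ℕ} {d : ℕ → ℝ}
    (hd : ∀ j, 1 ≤ j → j < N → d j < d (j + 1)) {i j : ℕ}
    (hi : 1 ≤ i) (hij : i < j) (hj : j ≤ N) : d i < d j := by
  induction j, hij using Nat.le_induction with
  | base => exact hd i hi (by omega)
  | succ k hk ih => exact (ih (by omega)).trans (hd k (by omega) (by omega))


/-- Lemma on deactivating user 1 with inactive block `2,…,m−1` and active `m`:
the multipliers only increase. -/
theorem deactivate_user_one_multipliers_increase (N : ℕ) (d Q : ℕ → ℝ)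
    (hd : ∀ j, 1 ≤ j → j < N → d j < d (j + 1))
    (hdpos : ∀ j, 1 ≤ j → j ≤ N → 0 < d j)
    (V N0 : ℝ) (hV : 0 < V) (hN0 : 0 < N0)
    (m : ℕ) (hm2 : 2 ≤ m) (hmN : m ≤ N)
    (lam lam' : ℕ → ℝ)
    (hlam : ∀ n, lam n = (Q 1 * (1 / d n - 1 / d m) + Q m * (1 / d 1 - 1 / d n)) /
        (1 / d 1 - 1 / d m) - Q n)
    (hlam' : ∀ n, 1 ≤ n → n ≤ m - 1 →
      lam' n = V * N0 * (1 / d n - 1 / d m) + Q m - Q n)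
    (hQ1 : Q 1 < V * N0 * (1 / d 1 - 1 / d 2) + Q 2 + lam 2) :
    Q 1 < V * N0 * (1 / d 1 - 1 / d m) + Q m ∧
    0 < lam' 1 ∧
    ∀ n, 2 ≤ n → n ≤ m - 1 →
      lam' n - lam n = ((1 / d n - 1 / d m) / (1 / d 1 - 1 / d m)) * lam' 1 ∧
      0 ≤ lam' n - lam n := by
  have hinv : ∀ i j, 1 ≤ i → i < j → j ≤ N → 1 / d j < 1 / d i := fun i j hi hij hj =>
    one_div_lt_one_div_of_lt (hdpos i hi (by omega)) (lt_of_stepwise_lt hd hi hij hj)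
  have hac : 0 < 1 / d 1 - 1 / d m := sub_pos.2 (hinv 1 m le_rfl (by omega) hmN)
  have hab : 0 < 1 / d 1 - 1 / d 2 := sub_pos.2 (hinv 1 2 le_rfl (by omega) (by omega))
  have hbound : Q 1 < V * N0 * (1 / d 1 - 1 / d m) + Q m := by
    have hgap : V * N0 * (1 / d 1 - 1 / d 2) + Q 2 + lam 2 - Q 1 =
        (1 / d 1 - 1 / d 2) / (1 / d 1 - 1 / d m) *
          (V * N0 * (1 / d 1 - 1 / d m) + Q m - Q 1) := by
      rw [hlam 2]
      generalize 1 / d 1 = a, 1 / d 2 = b, 1 / d m = c at *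
      have := hac.ne'
      field_simp
      ring
    have := pos_of_mul_pos_right (hgap ▸ sub_pos.2 hQ1) (div_pos hab hac).le
    linarith
  have hpos : 0 < lam' 1 := by
    rw [hlam' 1 le_rfl (by omega)]
    linarith
  refine ⟨hbound, hpos, fun n hn hnm => ?_⟩
  have hnc : 0 < 1 / d n - 1 / d m := sub_pos.2 (hinv n m (by omega) (by omega) hmN)
  have hdiff : lam' n - lam n =
      ((1 / d n - 1 / d m) / (1 / d 1 - 1 / d m)) * lam' 1 := by
    rw [hlam' n (by omega) hnm, hlam n, hlam' 1 le_rfl (by omega)]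
    generalize 1 / d 1 = a, 1 / d n = b, 1 / d m = c at *
    have := hac.ne'
    field_simp
    ring
  exact ⟨hdiff, hdiff ▸ (mul_pos (div_pos hnc hac) hpos).le⟩
end

section
/- Let 1 ≤ v < k ≤ N−1. For n ∈ {v,…,k} define λ_n = [Q_v(1/d_n − 1/d_k) + Q_k(1/d_v − 1/d_n)]/(1/d_v − 1/d_k) − Q_n (so λ_v = λ_k = 0). Suppose Q_k < [(Q_{k−1} + λ_{k−1})(1/d_k − 1/d_{k+1}) + Q_{k+1}(1/d_{k−1} − 1/d_k)] / (1/d_{k−1} − 1/d_{k+1}). Then: (a) Q_k < [Q_v(1/d_k − 1/d_{k+1}) + Q_{k+1}(1/d_v − 1/d_k)] / (1/d_v − 1/d_{k+1}); (b) setting λ'_n = [Q_v(1/d_n − 1/d_{k+1}) + Q_{k+1}(1/d_v − 1/d_n)]/(1/d_v − 1/d_{k+1}) − Q_n for n ∈ {v,…,k}, one has λ'_k > 0, and for every n ∈ {v+1,…,k−1}, λ'_n − λ_n = ((1/d_v − 1/d_n)/(1/d_v − 1/d_k)) · λ'_k ≥ 0. -/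
theorem one_div_lt_one_div_of_gains {N : ℕ} {d : ℕ → ℝ}
    (hd : ∀ j, 1 ≤ j → j < N → d j < d (j + 1))
    (hdpos : ∀ j, 1 ≤ j → j ≤ N → 0 < d j) {i j : ℕ} (hi : 1 ≤ i) (hij : i < j) (hj : j ≤ N) :
    1 / d j < 1 / d i := by
  refine one_div_lt_one_div_of_lt (hdpos i hi (by omega)) ?_
  induction j, hij using Nat.le_induction with
  | base => exact hd i hi (by omega)
  | succ m hm ih => exact (ih (by omega)).trans (hd m (by omega) (by omega))

/-- Replacing the left neighbour `b` by the farther point `a`, when the value at `b` is the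
linear interpolation between the values at `a` and `c`. -/
theorem lt_interpolation_of_lt_interpolation {a b c e x y z : ℝ} (hca : c < a) (hcb : c < b)
    (hec : e < c)
    (h : y < ((x * (b - c) + y * (a - b)) / (a - c) * (c - e) + z * (b - c)) / (b - e)) :
    y < (x * (c - e) + z * (a - c)) / (a - e) := by
  have hac : 0 < a - c := sub_pos.2 hca
  rw [lt_div_iff₀ (by linarith)] at h ⊢
  have h' := mul_lt_mul_of_pos_left h hac
  have heq : (a - c) * ((x * (b - c) + y * (a - b)) / (a - c) * (c - e) + z * (b - c)) =
      (x * (b - c) + y * (a - b)) * (c - e) + z * (b - c) * (a - c) := by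
    field_simp
  rw [heq] at h'
  exact lt_of_mul_lt_mul_left (by linarith) (sub_pos.2 hcb).le

/-- The difference of two linear interpolations from the same left endpoint `a` is linear. -/
theorem interpolation_sub_interpolation {a c e t x y z : ℝ} (hac : a - c ≠ 0) (hae : a - e ≠ 0) :
    (x * (t - e) + z * (a - t)) / (a - e) - (x * (t - c) + y * (a - t)) / (a - c) =
      (a - t) / (a - c) * ((x * (c - e) + z * (a - c)) / (a - e) - y) := by
  field_simp
  ring


/-- deactivating user `k` whose left inactive block is bounded by active user `v`
and whose right neighbor `k+1` is active with zero multiplier: the multipliers only increase. -/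
theorem deactivate_interior_user_right_active (N : ℕ) (d Q : ℕ → ℝ)
    (hd : ∀ j, 1 ≤ j → j < N → d j < d (j + 1))
    (hdpos : ∀ j, 1 ≤ j → j ≤ N → 0 < d j)
    (v k : ℕ) (hv : 1 ≤ v) (hvk : v < k) (hkN : k + 1 ≤ N)
    (lam lam' : ℕ → ℝ)
    (hlam : ∀ n, v ≤ n → n ≤ k →
      lam n = (Q v * (1 / d n - 1 / d k) + Q k * (1 / d v - 1 / d n)) /
        (1 / d v - 1 / d k) - Q n)
    (hlam' : ∀ n, v ≤ n → n ≤ k →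
      lam' n = (Q v * (1 / d n - 1 / d (k + 1)) + Q (k + 1) * (1 / d v - 1 / d n)) /
        (1 / d v - 1 / d (k + 1)) - Q n)
    (hQ : Q k < ((Q (k - 1) + lam (k - 1)) * (1 / d k - 1 / d (k + 1)) +
        Q (k + 1) * (1 / d (k - 1) - 1 / d k)) /
      (1 / d (k - 1) - 1 / d (k + 1))) :
    Q k < (Q v * (1 / d k - 1 / d (k + 1)) + Q (k + 1) * (1 / d v - 1 / d k)) /
      (1 / d v - 1 / d (k + 1)) ∧
    0 < lam' k ∧
    ∀ n, v + 1 ≤ n → n ≤ k - 1 →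
      lam' n - lam n = ((1 / d v - 1 / d n) / (1 / d v - 1 / d k)) * lam' k ∧
      0 ≤ lam' n - lam n := by
  have anti {i j : ℕ} (hi : 1 ≤ i) (hij : i < j) (hj : j ≤ N) : 1 / d j < 1 / d i :=
    one_div_lt_one_div_of_gains hd hdpos hi hij hj
  have hca : 1 / d k < 1 / d v := anti hv hvk (by omega)
  have hcb : 1 / d k < 1 / d (k - 1) := anti (by omega) (by omega) (by omega)
  have hec : 1 / d (k + 1) < 1 / d k := anti (by omega) (by omega) hkN
  rw [hlam (k - 1) (by omega) (by omega), add_sub_cancel] at hQ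
  have hlt := lt_interpolation_of_lt_interpolation hca hcb hec hQ
  have hpos : 0 < lam' k := by
    rw [hlam' k hvk.le le_rfl]
    exact sub_pos.2 hlt
  refine ⟨hlt, hpos, fun n hn hnk => ?_⟩
  have heq : lam' n - lam n = ((1 / d v - 1 / d n) / (1 / d v - 1 / d k)) * lam' k := by
    rw [hlam n (by omega) (by omega), hlam' n (by omega) (by omega), hlam' k hvk.le le_rfl,
      sub_sub_sub_cancel_right]
    exact interpolation_sub_interpolation (sub_pos.2 hca).ne' (sub_pos.2 (hec.trans hca)).ne'
  have hna : 1 / d n < 1 / d v := anti hv (by omega) (by omega)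
  refine ⟨heq, heq ▸ ?_⟩
  exact mul_nonneg (div_nonneg (sub_pos.2 hna).le (sub_pos.2 hca).le) hpos.le
end

section
/- Let 1 < k ≤ N−1. For n ∈ {1,…,k−1} define λ_n = V N_0 (1/d_n − 1/d_k) + Q_k − Q_n. Suppose Q_k < [(Q_{k−1} + λ_{k−1})(1/d_k − 1/d_{k+1}) + Q_{k+1}(1/d_{k−1} − 1/d_k)] / (1/d_{k−1} − 1/d_{k+1}). Then: (a) Q_k < V N_0 (1/d_k − 1/d_{k+1}) + Q_{k+1}; (b) setting λ'_n = V N_0 (1/d_n − 1/d_{k+1}) + Q_{k+1} − Q_n for n ∈ {1,…,k}, one has λ'_k > 0, and for every n ∈ {1,…,k−1}, λ'_n − λ_n = λ'_k ≥ 0. -/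
/-- deactivating user `k` whose whole prefix `1,…,k−1` is inactive and whose
right neighbor `k+1` is active with zero multiplier: the multipliers only increase. -/
theorem deactivate_prefix_user_right_active (N : ℕ) (d Q : ℕ → ℝ)
    (hd : ∀ j, 1 ≤ j → j < N → d j < d (j + 1))
    (hdpos : ∀ j, 1 ≤ j → j ≤ N → 0 < d j)
    (V N0 : ℝ) (hV : 0 < V) (hN0 : 0 < N0)
    (k : ℕ) (hk1 : 1 < k) (hkN : k + 1 ≤ N)
    (lam lam' : ℕ → ℝ)
    (hlam : ∀ n, 1 ≤ n → n ≤ k - 1 →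
      lam n = V * N0 * (1 / d n - 1 / d k) + Q k - Q n)
    (hlam' : ∀ n, 1 ≤ n → n ≤ k →
      lam' n = V * N0 * (1 / d n - 1 / d (k + 1)) + Q (k + 1) - Q n)
    (hQ : Q k < ((Q (k - 1) + lam (k - 1)) * (1 / d k - 1 / d (k + 1)) +
        Q (k + 1) * (1 / d (k - 1) - 1 / d k)) /
      (1 / d (k - 1) - 1 / d (k + 1))) :
    Q k < V * N0 * (1 / d k - 1 / d (k + 1)) + Q (k + 1) ∧
    0 < lam' k ∧
    ∀ n, 1 ≤ n → n ≤ k - 1 →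
      lam' n - lam n = lam' k ∧ 0 ≤ lam' n - lam n := by
  have hd₁ : d (k - 1) < d k := by
    simpa [Nat.sub_add_cancel hk1.le] using hd (k - 1) (by omega) (by omega)
  have ha : 0 < 1 / d (k - 1) - 1 / d k :=
    sub_pos.2 (one_div_lt_one_div_of_lt (hdpos _ (by omega) (by omega)) hd₁)
  have hb : 0 < 1 / d k - 1 / d (k + 1) :=
    sub_pos.2 (one_div_lt_one_div_of_lt (hdpos k hk1.le (by omega)) (hd k hk1.le (by omega)))
  have hQk : Q k < V * N0 * (1 / d k - 1 / d (k + 1)) + Q (k + 1) := by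
    rw [lt_div_iff₀ (by linarith), hlam (k - 1) (by omega) le_rfl] at hQ
    refine lt_of_mul_lt_mul_right ?_ ha.le
    linear_combination hQ
  have hpos : 0 < lam' k := by
    rw [hlam' k hk1.le le_rfl]
    linarith
  refine ⟨hQk, hpos, fun n hn hnk => ?_⟩
  have hdiff : lam' n - lam n = lam' k := by
    rw [hlam' n hn (by omega), hlam n hn hnk, hlam' k hk1.le le_rfl]
    ring
  exact ⟨hdiff, hdiff ▸ hpos.le⟩
end

section
/- Let 1 < k < u ≤ N. For n ∈ {1,…,k−1} define λ_n = V N_0(1/d_n − 1/d_k) + Q_k − Q_n, and for n ∈ {k,…,u} define λ_n = [Q_k(1/d_n − 1/d_u) + Q_u(1/d_k − 1/d_n)]/(1/d_k − 1/d_u) − Q_n (so λ_k = λ_u = 0). Suppose Q_k < [(Q_{k−1}+λ_{k−1})(1/d_k − 1/d_{k+1}) + (Q_{k+1}+λ_{k+1})(1/d_{k−1} − 1/d_k)] / (1/d_{k−1} − 1/d_{k+1}). Then: (a) Q_k < V N_0(1/d_k − 1/d_u) + Q_u; (b) setting λ'_n = V N_0(1/d_n − 1/d_u) + Q_u − Q_n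 for n ∈ {1,…,u}, one has λ'_k > 0; for every n ∈ {1,…,k−1}, λ'_n − λ_n = λ'_k > 0; and for every n ∈ {k+1,…,u−1}, λ'_n − λ_n = ((1/d_n − 1/d_u)/(1/d_k − 1/d_u)) · λ'_k ≥ 0. -/
/-- Lying strictly below the chord between two neighbouring interpolated queue lengths, the left
one on a line of slope `W` through `q` and the right one on the chord from `q` to `r`, forces `q`
below the line of slope `W` through `r`. -/
theorem lt_of_lt_interpolation {W a b c e q r : ℝ} (hab : b < a) (hbc : c < b) (hbe : e < b)
    (h : q < ((W * (a - b) + q) * (b - c) +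
      (q * (c - e) + r * (b - c)) / (b - e) * (a - b)) / (a - c)) :
    q < W * (b - e) + r := by
  have hbe' : 0 < b - e := sub_pos.mpr hbe
  rw [lt_div_iff₀ (by linarith)] at h
  have key : (W * (a - b) + q) * (b - c) + (q * (c - e) + r * (b - c)) / (b - e) * (a - b)
      - q * (a - c) = (a - b) * (b - c) / (b - e) * (W * (b - e) + r - q) := by
    field_simp
    ring
  have hcoef : 0 < (a - b) * (b - c) / (b - e) :=
    div_pos (mul_pos (sub_pos.mpr hab) (sub_pos.mpr hbc)) hbe'
  have := pos_of_mul_pos_right (key ▸ sub_pos.mpr h) hcoef.le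
  linarith


/-- deactivating user `k` whose whole prefix `1,…,k−1` is inactive and whose
right inactive block is bounded by active user `u`: the multipliers only increase. -/
theorem deactivate_prefix_user_two_sided (N : ℕ) (d Q : ℕ → ℝ)
    (hd : ∀ j, 1 ≤ j → j < N → d j < d (j + 1))
    (hdpos : ∀ j, 1 ≤ j → j ≤ N → 0 < d j)
    (V N0 : ℝ) (hV : 0 < V) (hN0 : 0 < N0)
    (k u : ℕ) (hk1 : 1 < k) (hku : k < u) (huN : u ≤ N)
    (lam lam' : ℕ → ℝ)
    (hlam1 : ∀ n, 1 ≤ n → n ≤ k - 1 →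
      lam n = V * N0 * (1 / d n - 1 / d k) + Q k - Q n)
    (hlam2 : ∀ n, k ≤ n → n ≤ u →
      lam n = (Q k * (1 / d n - 1 / d u) + Q u * (1 / d k - 1 / d n)) /
        (1 / d k - 1 / d u) - Q n)
    (hlam' : ∀ n, 1 ≤ n → n ≤ u →
      lam' n = V * N0 * (1 / d n - 1 / d u) + Q u - Q n)
    (hQ : Q k < ((Q (k - 1) + lam (k - 1)) * (1 / d k - 1 / d (k + 1)) +
        (Q (k + 1) + lam (k + 1)) * (1 / d (k - 1) - 1 / d k)) /
      (1 / d (k - 1) - 1 / d (k + 1))) :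
    Q k < V * N0 * (1 / d k - 1 / d u) + Q u ∧
    0 < lam' k ∧
    (∀ n, 1 ≤ n → n ≤ k - 1 →
      lam' n - lam n = lam' k ∧ 0 < lam' n - lam n) ∧
    (∀ n, k + 1 ≤ n → n ≤ u - 1 →
      lam' n - lam n = ((1 / d n - 1 / d u) / (1 / d k - 1 / d u)) * lam' k ∧
      0 ≤ lam' n - lam n) := by
  have hlt {i j : ℕ} (hi : 1 ≤ i) (hij : i < j) (hj : j ≤ N) : 1 / d j < 1 / d i :=
    one_div_lt_one_div_of_gains hd hdpos hi hij hj
  have hbe : 1 / d u < 1 / d k := hlt hk1.le hku huN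
  have hmain : Q k < V * N0 * (1 / d k - 1 / d u) + Q u := by
    refine lt_of_lt_interpolation (hlt (i := k - 1) (by lia) (by lia) (by lia))
      (hlt (j := k + 1) hk1.le (by lia) (by lia)) hbe ?_
    rw [hlam1 (k - 1) (by lia) le_rfl, hlam2 (k + 1) (by lia) (by lia)] at hQ
    simpa only [add_sub_cancel] using hQ
  have hk' := hlam' k hk1.le hku.le
  have hpos : 0 < lam' k := by linarith
  refine ⟨hmain, hpos, fun n h1 hn => ?_, fun n hn hnu => ?_⟩
  · have heq : lam' n - lam n = lam' k := by
      rw [hlam' n h1 (by lia), hlam1 n h1 hn, hk']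
      ring
    exact ⟨heq, heq ▸ hpos⟩
  · have heq : lam' n - lam n = ((1 / d n - 1 / d u) / (1 / d k - 1 / d u)) * lam' k := by
      have hne : 1 / d k - 1 / d u ≠ 0 := (sub_pos.mpr hbe).ne'
      rw [hlam' n (by lia) (by lia), hlam2 n (by lia) (by lia), hk']
      generalize 1 / d k = b at *
      generalize 1 / d u = e at *
      generalize 1 / d n = x at *
      field_simp
      ring
    have hxe : 1 / d u < 1 / d n := hlt (by lia) (by lia) huN
    refine ⟨heq, heq ▸ mul_nonneg (div_nonneg ?_ ?_) hpos.le⟩ <;> linarith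
end
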